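/- Let a<b be real numbers and let T: D_cdf([a,b]) → ℝ and a nonempty convex D ⊆ D_cdf([a,b]) satisfy the Lipschitz assumption with constant C>0. Let M ⊆ S_K be closed, let M^n ⊆ M be finite and nonempty, let F = (F¹,…,F^K) with each F^i ∈ D, and let G = (G¹,…,G^K) with each G^i ∈ D_cdf([a,b]). If δ̂ ∈ argmax_{δ∈M^n} T(⟨δ, G⟩), then max_{δ∈M} T(⟨δ,F⟩) − T(⟨δ̂, F⟩) ≤ ε + 2C · max_{j=1,…,K} ‖G^j − F^j‖_∞, where ε := max_{δ∈M} T(⟨δ,F⟩) − max_{δ∈M^n} T(⟨δ,F⟩). In particular, |max_{δ∈M^n} T(⟨δ,G⟩) − max_{δ∈M^n} T(⟨δ,F⟩)| ≤ C · max_{j=1,…,K} ‖G^j − F^j‖_∞. -/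

import Mathlib

open MeasureTheory Set

noncomputable section

namespace TRDT

/-- `F` is a cumulative distribution function on `[a,b]`. -/
def IsCdfOn (a b : ℝ) (F : ℝ → ℝ) : Prop :=
  Monotone F ∧ (∀ x, ContinuousWithinAt F (Set.Ici x) x) ∧
    (∀ x, x < a → F x = 0) ∧ (∀ x, b ≤ x → F x = 1)

/-- Kolmogorov (supremum) distance `‖F - G‖_∞`. -/
def supDist (F G : ℝ → ℝ) : ℝ := ⨆ x : ℝ, |F x - G x|

/-- `|T F - T G| ≤ C ‖F - G‖_∞` for every `F ∈ D` and every cdf `G` on `[a,b]`. -/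
def LipschitzAssumption (a b : ℝ) (T : (ℝ → ℝ) → ℝ) (D : Set (ℝ → ℝ)) (C : ℝ) : Prop :=
  ∀ F ∈ D, ∀ G : ℝ → ℝ, IsCdfOn a b G → |T F - T G| ≤ C * supDist F G

/-- The mixture cdf `⟨δ, F⟩ = ∑ i δ_i F^i`. -/
def mix {K : ℕ} (δ : Fin K → ℝ) (F : Fin K → ℝ → ℝ) : ℝ → ℝ := fun x => ∑ i, δ i * F i x

lemma IsCdfOn.mem_Icc {a b : ℝ} {F : ℝ → ℝ} (h : IsCdfOn a b F) (x : ℝ) :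
    0 ≤ F x ∧ F x ≤ 1 := by
  obtain ⟨hm, -, h0, h1⟩ := h
  constructor
  · have h2 := h0 (min x (a - 1)) (lt_of_le_of_lt (min_le_right _ _) (by linarith))
    rw [← h2]
    exact hm (min_le_left _ _)
  · rw [← h1 (max x b) (le_max_right _ _)]
    exact hm (le_max_left _ _)

lemma abs_le_supDist {a b : ℝ} {F G : ℝ → ℝ} (hF : IsCdfOn a b F) (hG : IsCdfOn a b G) (x : ℝ) :
    |F x - G x| ≤ supDist F G := by
  refine le_ciSup (f := fun x => |F x - G x|) ⟨1, ?_⟩ x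
  rintro _ ⟨y, rfl⟩
  have h1 := hF.mem_Icc y
  have h2 := hG.mem_Icc y
  exact abs_le.2 ⟨by linarith, by linarith⟩

lemma mix_isCdfOn {a b : ℝ} {K : ℕ} {δ : Fin K → ℝ} (hδ : δ ∈ stdSimplex ℝ (Fin K))
    {G : Fin K → ℝ → ℝ} (hG : ∀ i, IsCdfOn a b (G i)) : IsCdfOn a b (mix δ G) := by
  refine ⟨?_, ?_, ?_, ?_⟩
  · intro x y hxy
    exact Finset.sum_le_sum fun i _ => mul_le_mul_of_nonneg_left ((hG i).1 hxy) (hδ.1 i)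
  · intro x
    show Filter.Tendsto _ _ _
    exact tendsto_finsetSum _ fun i _ => ((hG i).2.1 x).const_mul (δ i)
  · intro x hx
    exact Finset.sum_eq_zero fun i _ => by rw [(hG i).2.2.1 x hx, mul_zero]
  · intro x hx
    rw [← hδ.2]
    exact Finset.sum_congr rfl fun i _ => by rw [(hG i).2.2.2 x hx, mul_one]

lemma supDist_mix_le {a b : ℝ} {K : ℕ} {δ : Fin K → ℝ} (hδ : δ ∈ stdSimplex ℝ (Fin K))
    {F G : Fin K → ℝ → ℝ} (hF : ∀ i, IsCdfOn a b (F i)) (hG : ∀ i, IsCdfOn a b (G i)) :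
    supDist (mix δ F) (mix δ G) ≤ ⨆ j : Fin K, supDist (G j) (F j) := by
  refine ciSup_le fun x => ?_
  have hx : ∀ i, |F i x - G i x| ≤ ⨆ j : Fin K, supDist (G j) (F j) := fun i => by
    rw [abs_sub_comm]
    exact (abs_le_supDist (hG i) (hF i) x).trans
      (le_ciSup (f := fun j => supDist (G j) (F j)) (Set.finite_range _).bddAbove i)
  calc |mix δ F x - mix δ G x| = |∑ i, δ i * (F i x - G i x)| := by
        simp only [mix, mul_sub, Finset.sum_sub_distrib]
    _ ≤ ∑ i, |δ i * (F i x - G i x)| := Finset.abs_sum_le_sum_abs _ _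
    _ ≤ ∑ i, δ i * (⨆ j : Fin K, supDist (G j) (F j)) := by
        refine Finset.sum_le_sum fun i _ => ?_
        rw [abs_mul, abs_of_nonneg (hδ.1 i)]
        exact mul_le_mul_of_nonneg_left (hx i) (hδ.1 i)
    _ = _ := by rw [← Finset.sum_mul, hδ.2, one_mul]

/-- The key deterministic regret bound from the proof of Theorem 3: if `δ̂` maximizes
`δ ↦ T(⟨δ, G⟩)` over the finite set `M^n ⊆ M`, then
`max_{δ∈M} T(⟨δ,F⟩) − T(⟨δ̂,F⟩) ≤ ε + 2C·max_j ‖G^j − F^j‖_∞`, where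
`ε = max_{δ∈M} T(⟨δ,F⟩) − max_{δ∈M^n} T(⟨δ,F⟩)`; in particular the plug-in maximum is
within `C·max_j ‖G^j − F^j‖_∞` of the true one. -/
theorem regret_le_eps_add_two_mul_supDist
    (a b : ℝ) (hab : a < b)
    (T : (ℝ → ℝ) → ℝ) (D : Set (ℝ → ℝ)) (hDne : D.Nonempty)
    (hDcdf : ∀ F ∈ D, IsCdfOn a b F) (hDconv : Convex ℝ D)
    (C : ℝ) (hC : 0 < C) (hLip : LipschitzAssumption a b T D C)
    (K : ℕ) (hK : 1 ≤ K)
    (M : Set (Fin K → ℝ)) (hMsub : M ⊆ stdSimplex ℝ (Fin K)) (hMclosed : IsClosed M)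
    (Mn : Finset (Fin K → ℝ)) (hMnsub : (Mn : Set (Fin K → ℝ)) ⊆ M) (hMnne : Mn.Nonempty)
    (F G : Fin K → ℝ → ℝ) (hF : ∀ i, F i ∈ D) (hG : ∀ i, IsCdfOn a b (G i))
    (δhat : Fin K → ℝ) (hδhat : δhat ∈ Mn)
    (hargmax : ∀ γ ∈ Mn, T (mix γ G) ≤ T (mix δhat G)) :
    sSup ((fun δ => T (mix δ F)) '' M) - T (mix δhat F)
      ≤ (sSup ((fun δ => T (mix δ F)) '' M)
            - sSup ((fun δ => T (mix δ F)) '' (Mn : Set (Fin K → ℝ))))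
        + 2 * C * (⨆ j : Fin K, supDist (G j) (F j)) ∧
    |sSup ((fun δ => T (mix δ G)) '' (Mn : Set (Fin K → ℝ)))
        - sSup ((fun δ => T (mix δ F)) '' (Mn : Set (Fin K → ℝ)))|
      ≤ C * (⨆ j : Fin K, supDist (G j) (F j)) := by
  have key : ∀ δ ∈ Mn, |T (mix δ F) - T (mix δ G)| ≤ C * (⨆ j : Fin K, supDist (G j) (F j)) := by
    intro δ hδ
    have hs := hMsub (hMnsub hδ)
    have hD : mix δ F ∈ D := by
      have h1 : mix δ F = ∑ i, δ i • F i := by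
        ext x
        simp [mix, Finset.sum_apply]
      rw [h1]
      exact hDconv.sum_mem (fun i _ => hs.1 i) hs.2 (fun i _ => hF i)
    exact (hLip _ hD _ (mix_isCdfOn hs hG)).trans (mul_le_mul_of_nonneg_left
      (supDist_mix_le hs (fun i => hDcdf _ (hF i)) hG) hC.le)
  have eG : sSup ((fun δ => T (mix δ G)) '' (Mn : Set (Fin K → ℝ))) = T (mix δhat G) := by
    refine IsGreatest.csSup_eq ⟨⟨δhat, hδhat, rfl⟩, ?_⟩
    rintro _ ⟨γ, hγ, rfl⟩
    exact hargmax γ hγ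
  obtain ⟨γ, hγ, hmax⟩ := Mn.exists_max_image (fun δ => T (mix δ F)) hMnne
  have eF : sSup ((fun δ => T (mix δ F)) '' (Mn : Set (Fin K → ℝ))) = T (mix γ F) := by
    refine IsGreatest.csSup_eq ⟨⟨γ, hγ, rfl⟩, ?_⟩
    rintro _ ⟨γ', hγ', rfl⟩
    exact hmax γ' hγ'
  rw [eG, eF]
  have k1 := abs_le.1 (key γ hγ)
  have k2 := abs_le.1 (key δhat hδhat)
  have k3 := hargmax γ hγ
  have k4 := hmax δhat hδhat
  refine ⟨by linarith, abs_le.2 ⟨by linarith, by linarith⟩⟩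

end TRDT
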